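/- arXiv:1809.02497 — 3 statements merged into one kernel-verified Lean document; each statement's English description precedes it below -/
import Mathlib

section
/- Let β be a real n×m matrix (n ≥ m) with thin singular value decomposition β = U Σ Vᵀ, where U is an n×m real matrix with Uᵀ U = I_m, Σ is an m×m diagonal matrix with nonnegative diagonal entries, and V is an m×m orthogonal matrix. Then for every n×m real matrix α satisfying αᵀ α = I_m, one has tr(αᵀ β) ≤ tr(Σ). -/
open Matrix

/-- Corresponding columns of two real matrices with orthonormal columns have inner product at
most one. -/
theorem transpose_mul_apply_self_le_one {ι κ : Type*} [Fintype ι] [DecidableEq κ]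
    {A B : Matrix ι κ ℝ} (hA : Aᵀ * A = 1) (hB : Bᵀ * B = 1) (i : κ) :
    (Aᵀ * B) i i ≤ 1 := by
  have hAi : ∑ k, A k i * A k i = 1 := by
    simpa [Matrix.mul_apply] using congrFun (congrFun hA i) i
  have hBi : ∑ k, B k i * B k i = 1 := by
    simpa [Matrix.mul_apply] using congrFun (congrFun hB i) i
  have h : ∑ k, 2 * (A k i * B k i) ≤ ∑ k, (A k i * A k i + B k i * B k i) :=
    Finset.sum_le_sum fun k _ => by nlinarith [sq_nonneg (A k i - B k i)]
  rw [← Finset.mul_sum, Finset.sum_add_distrib, hAi, hBi] at h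
  simp only [Matrix.mul_apply, Matrix.transpose_apply]
  linarith

/-- Thin SVD gives `tr(αᵀ β) ≤ tr(Σ)` for any `α` with orthonormal columns. -/
theorem stmt_0 (n m : ℕ) (hnm : m ≤ n)
    (β U : Matrix (Fin n) (Fin m) ℝ) (σ : Fin m → ℝ)
    (V : Matrix (Fin m) (Fin m) ℝ)
    (hU : Uᵀ * U = 1) (hσ : ∀ i, 0 ≤ σ i)
    (hV₁ : Vᵀ * V = 1) (hV₂ : V * Vᵀ = 1)
    (hβ : β = U * Matrix.diagonal σ * Vᵀ) :
    ∀ α : Matrix (Fin n) (Fin m) ℝ, αᵀ * α = 1 →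
      (αᵀ * β).trace ≤ (Matrix.diagonal σ).trace := by
  intro α hα
  have hαV : (α * V)ᵀ * (α * V) = 1 := by
    rw [Matrix.transpose_mul, Matrix.mul_assoc, ← Matrix.mul_assoc αᵀ, hα, Matrix.one_mul, hV₁]
  have htr : (αᵀ * β).trace = ((α * V)ᵀ * U * Matrix.diagonal σ).trace := by
    rw [hβ, ← Matrix.mul_assoc, Matrix.trace_mul_comm, Matrix.transpose_mul]
    simp only [Matrix.mul_assoc]
  rw [htr]
  refine Finset.sum_le_sum fun i _ => ?_
  simp only [Matrix.diag_apply, Matrix.mul_diagonal, Matrix.diagonal_apply_eq]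
  exact mul_le_of_le_one_left (hσ i) (transpose_mul_apply_self_le_one hαV hU i)
end

section
/- Let K be a real symmetric positive semidefinite n×n matrix whose largest eigenvalue d₁ is strictly positive, let e₁ ∈ ℝⁿ be a unit eigenvector of K with eigenvalue d₁, and let λ > 0. Then the vector α̂ = e₁/√d₁ satisfies α̂ᵀ K α̂ = 1 and α̂ᵀ K² (K² + λI)^{-1} K² α̂ = d₁³/(d₁² + λ), and for every α ∈ ℝⁿ with αᵀ K α = 1 one has αᵀ K² (K² + λI)^{-1} K² α ≤ d₁³/(d₁² + λ). -/
open Matrix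

theorem Matrix.PosSemidef.isUnit_sq_add_smul_one {n : Type*} [Fintype n] [DecidableEq n]
    {K : Matrix n n ℝ} (hK : K.PosSemidef) {lam : ℝ} (hlam : 0 < lam) :
    IsUnit (K * K + lam • (1 : Matrix n n ℝ)) := by
  have hsq : (K * K).PosSemidef := by
    have h := Matrix.posSemidef_conjTranspose_mul_self K
    rwa [hK.isHermitian.eq] at h
  exact (Matrix.PosDef.posSemidef_add hsq (Matrix.PosDef.one.smul hlam)).isUnit

theorem Matrix.PosSemidef.sq_mul_inv_mul_sq_mulVec {n : Type*} [Fintype n] [DecidableEq n]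
    {K : Matrix n n ℝ} (hK : K.PosSemidef) {lam : ℝ} (hlam : 0 < lam)
    {d : ℝ} {v : n → ℝ} (hv : K *ᵥ v = d • v) :
    (K * K * (K * K + lam • (1 : Matrix n n ℝ))⁻¹ * (K * K)) *ᵥ v =
      (d ^ 4 / (d ^ 2 + lam)) • v := by
  have hsq : (K * K) *ᵥ v = d ^ 2 • v := by
    rw [← mulVec_mulVec, hv, mulVec_smul, hv, smul_smul, sq]
  have hpos : d ^ 2 + lam ≠ 0 := by positivity
  have hreg : (K * K + lam • (1 : Matrix n n ℝ)) *ᵥ v = (d ^ 2 + lam) • v := by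
    rw [add_mulVec, hsq, smul_mulVec, one_mulVec, add_smul]
  have hinv : (K * K + lam • (1 : Matrix n n ℝ))⁻¹ *ᵥ v = (d ^ 2 + lam)⁻¹ • v := by
    have hunit := (Matrix.isUnit_iff_isUnit_det _).mp (hK.isUnit_sq_add_smul_one hlam)
    rw [eq_inv_smul_iff₀ hpos, ← mulVec_smul, ← hreg, mulVec_mulVec,
      nonsing_inv_mul _ hunit, one_mulVec]
  rw [← mulVec_mulVec, hsq, mulVec_smul, ← mulVec_mulVec, hinv, mulVec_smul, hsq, smul_smul,
    smul_smul]
  congr 1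
  field_simp

theorem OrthonormalBasis.dotProduct_mulVec_eq_sum {n ι : Type*} [Fintype n] [Fintype ι]
    (b : OrthonormalBasis ι ℝ (EuclideanSpace ℝ n)) (A : Matrix n n ℝ) (g : ι → ℝ)
    (hA : ∀ i, A *ᵥ (b i).ofLp = g i • (b i).ofLp) (x : n → ℝ) :
    x ⬝ᵥ (A *ᵥ x) = ∑ i, g i * (x ⬝ᵥ (b i).ofLp) ^ 2 := by
  have hx : x = ∑ i, (x ⬝ᵥ (b i).ofLp) • (b i).ofLp := by
    simpa [EuclideanSpace.inner_eq_star_dotProduct] using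
      (congrArg WithLp.ofLp (b.sum_repr' (WithLp.toLp 2 x))).symm
  have hAx : A *ᵥ x = ∑ i, (x ⬝ᵥ (b i).ofLp) • (g i • (b i).ofLp) := by
    conv_lhs => rw [hx]
    simp only [mulVec_sum, mulVec_smul, hA]
  rw [hAx, dotProduct_sum]
  refine Finset.sum_congr rfl fun i _ => ?_
  simp only [dotProduct_smul, smul_eq_mul]
  ring

theorem pow_four_div_sq_add_le {x d lam : ℝ} (hx : 0 ≤ x) (hxd : x ≤ d) (hlam : 0 < lam) :
    x ^ 4 / (x ^ 2 + lam) ≤ d ^ 3 / (d ^ 2 + lam) * x := by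
  have hcube : x ^ 3 ≤ d ^ 3 := by gcongr
  have hle : x ^ 3 / (x ^ 2 + lam) ≤ d ^ 3 / (d ^ 2 + lam) := by
    rw [div_le_div_iff₀ (by positivity) (by positivity)]
    nlinarith [mul_nonneg hlam.le (sub_nonneg.2 hcube),
      mul_nonneg (sq_nonneg (x * d)) (sub_nonneg.2 hxd)]
  calc x ^ 4 / (x ^ 2 + lam) = x ^ 3 / (x ^ 2 + lam) * x := by ring
    _ ≤ d ^ 3 / (d ^ 2 + lam) * x := by gcongr

/-- `α̂ = e₁/√d₁` attains the maximum `d₁³/(d₁² + λ)` of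
`αᵀ K² (K² + λI)⁻¹ K² α` over `{α | αᵀ K α = 1}`. -/
theorem stmt_9 {n : ℕ} (K : Matrix (Fin n) (Fin n) ℝ)
    (hK : K.PosSemidef) (d₁ : ℝ) (hd₁ : 0 < d₁)
    (e₁ : Fin n → ℝ) (he₁ : e₁ ⬝ᵥ e₁ = 1) (heig : K *ᵥ e₁ = d₁ • e₁)
    (hmax : ∀ (d : ℝ) (v : Fin n → ℝ), v ≠ 0 → K *ᵥ v = d • v → d ≤ d₁)
    (lam : ℝ) (hlam : 0 < lam) :
    ((Real.sqrt d₁)⁻¹ • e₁) ⬝ᵥ (K *ᵥ ((Real.sqrt d₁)⁻¹ • e₁)) = 1 ∧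
    ((Real.sqrt d₁)⁻¹ • e₁) ⬝ᵥ
        ((K * K * (K * K + lam • (1 : Matrix (Fin n) (Fin n) ℝ))⁻¹ * (K * K)) *ᵥ
          ((Real.sqrt d₁)⁻¹ • e₁)) = d₁ ^ 3 / (d₁ ^ 2 + lam) ∧
    ∀ α : Fin n → ℝ, α ⬝ᵥ (K *ᵥ α) = 1 →
      α ⬝ᵥ ((K * K * (K * K + lam • (1 : Matrix (Fin n) (Fin n) ℝ))⁻¹ * (K * K)) *ᵥ α)
        ≤ d₁ ^ 3 / (d₁ ^ 2 + lam) := by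
  have hscale : (Real.sqrt d₁)⁻¹ * (Real.sqrt d₁)⁻¹ = d₁⁻¹ := by
    rw [← mul_inv, Real.mul_self_sqrt hd₁.le]
  have hquad : ∀ (A : Matrix (Fin n) (Fin n) ℝ) (g : ℝ), A *ᵥ e₁ = g • e₁ →
      ((Real.sqrt d₁)⁻¹ • e₁) ⬝ᵥ (A *ᵥ ((Real.sqrt d₁)⁻¹ • e₁)) = d₁⁻¹ * g := by
    intro A g hA
    rw [mulVec_smul, hA, smul_dotProduct, dotProduct_smul, dotProduct_smul, he₁, ← hscale]
    simp only [smul_eq_mul]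
    ring
  refine ⟨?_, ?_, fun α hα => ?_⟩
  · rw [hquad K d₁ heig, inv_mul_cancel₀ hd₁.ne']
  · rw [hquad _ _ (hK.sq_mul_inv_mul_sq_mulVec hlam heig)]
    field_simp
  · have hH := hK.isHermitian
    have hev : ∀ i, K *ᵥ (hH.eigenvectorBasis i).ofLp =
        hH.eigenvalues i • (hH.eigenvectorBasis i).ofLp := hH.mulVec_eigenvectorBasis
    have hle : ∀ i, hH.eigenvalues i ≤ d₁ := fun i =>
      hmax _ _ (by simpa using hH.eigenvectorBasis.orthonormal.ne_zero i) (hev i)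
    rw [hH.eigenvectorBasis.dotProduct_mulVec_eq_sum K _ hev] at hα
    rw [hH.eigenvectorBasis.dotProduct_mulVec_eq_sum _ _
      fun i => hK.sq_mul_inv_mul_sq_mulVec hlam (hev i)]
    calc _ ≤ ∑ i, d₁ ^ 3 / (d₁ ^ 2 + lam) *
          (hH.eigenvalues i * (α ⬝ᵥ (hH.eigenvectorBasis i).ofLp) ^ 2) := by
          refine Finset.sum_le_sum fun i _ => ?_
          rw [← mul_assoc]
          exact mul_le_mul_of_nonneg_right
            (pow_four_div_sq_add_le (hK.eigenvalues_nonneg i) (hle i) hlam) (sq_nonneg _)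
      _ = d₁ ^ 3 / (d₁ ^ 2 + lam) := by rw [← Finset.mul_sum, hα, mul_one]
end

section
/- Let x_i, x_f, x_g, x' be elements of a real inner product space and let d, d̃ ≥ 0 be real numbers such that ‖x_i − x_f‖ ≤ d, ‖x_g − x'‖ ≤ d, and ‖x_f − x_g‖ ≤ d̃. Then exp(−3d² − 2d·d̃) ≤ exp(−‖x_i − x'‖²) / exp(−‖x_f − x'‖²) ≤ exp(2d² + 2d·d̃). -/
/-- Under the distance bounds `‖xᵢ−x_f‖ ≤ d`, `‖x_g−x'‖ ≤ d`, `‖x_f−x_g‖ ≤ d̃`, the ratio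
`exp(−‖xᵢ−x'‖²)/exp(−‖x_f−x'‖²)` lies in `[exp(−3d²−2d·d̃), exp(2d²+2d·d̃)]`. -/
theorem stmt_12 {E : Type*} [NormedAddCommGroup E] [InnerProductSpace ℝ E]
    (xi xf xg x' : E) (d dt : ℝ) (hd : 0 ≤ d) (hdt : 0 ≤ dt)
    (h1 : ‖xi - xf‖ ≤ d) (h2 : ‖xg - x'‖ ≤ d) (h3 : ‖xf - xg‖ ≤ dt) :
    Real.exp (-(3 * d ^ 2) - 2 * d * dt) ≤
        Real.exp (-‖xi - x'‖ ^ 2) / Real.exp (-‖xf - x'‖ ^ 2) ∧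
      Real.exp (-‖xi - x'‖ ^ 2) / Real.exp (-‖xf - x'‖ ^ 2) ≤
        Real.exp (2 * d ^ 2 + 2 * d * dt) := by
  have hb : ‖xf - x'‖ ≤ d + dt := by
    linarith [norm_sub_le_norm_sub_add_norm_sub xf xg x']
  have hexpand : ‖xi - x'‖ ^ 2 =
      ‖xi - xf‖ ^ 2 + 2 * inner ℝ (xi - xf) (xf - x') + ‖xf - x'‖ ^ 2 := by
    rw [← norm_add_sq_real, sub_add_sub_cancel]
  have hinner : |inner ℝ (xi - xf) (xf - x')| ≤ d * (d + dt) :=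
    (abs_real_inner_le_norm _ _).trans (mul_le_mul h1 hb (norm_nonneg _) hd)
  have hsq : ‖xi - xf‖ ^ 2 ≤ d ^ 2 := pow_le_pow_left₀ (norm_nonneg _) h1 2
  obtain ⟨hlower, hupper⟩ := abs_le.mp hinner
  rw [← Real.exp_sub, Real.exp_le_exp, Real.exp_le_exp]
  constructor
  · linarith
  · linarith [sq_nonneg ‖xi - xf‖]
end
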